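/- There exists a countable metrizable semitopological semilattice X whose partial order P = {(x,y) ∈ X × X : xy = x} is a dense non-closed subset of X × X. -/

import Mathlib

namespace GenericSemilattice

/-- A sequence of finite families of finite sets in which every such family occurs
infinitely often. -/
def family (n : ℕ) : Finset (Finset ℕ) :=
  (Encodable.decode (α := Finset (Finset ℕ)) n.unpair.2).getD ∅

/-- A generic two-colouring of the finite sets of naturals: the largest element of a set prescribes
the colours of all sets obtained by adding it to sets of smaller numbers. -/
def colour (s : Finset ℕ) : Bool :=
  decide (s.erase (s.sup id) ∈ family (s.sup id))

lemma colour_insert {n : ℕ} {a : Finset ℕ} (h : ∀ i ∈ a, i < n) :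
    colour (insert n a) = decide (a ∈ family n) := by
  have hsup : (insert n a).sup id = n := by
    rw [Finset.sup_insert]
    exact sup_eq_left.2 (Finset.sup_le fun i hi => (h i hi).le)
  have hn : n ∉ a := fun hn => (h n hn).false
  rw [colour, hsup, Finset.erase_insert hn]

/-- Any prescribed colours on finitely many sets are realised by adding one large number. -/
lemma exists_colour_insert (A : Finset (Finset ℕ)) (p : Finset ℕ → Bool) :
    ∃ n, (∀ a ∈ A, ∀ i ∈ a, i < n) ∧ ∀ a ∈ A, colour (insert n a) = p a := by
  set S := A.filter fun a => p a = true
  set k := (A.sup id).sup id + 1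
  have hlt : ∀ a ∈ A, ∀ i ∈ a, i < Nat.pair k (Encodable.encode S) := fun a ha i hi =>
    calc i ≤ (A.sup id).sup id :=
          Finset.le_sup (f := id) (Finset.mem_sup.2 ⟨a, ha, hi⟩)
      _ < k := Nat.lt_succ_self _
      _ ≤ _ := Nat.left_le_pair _ _
  refine ⟨_, hlt, fun a ha => ?_⟩
  rw [colour_insert (hlt a ha)]
  simp [family, S, ha]

/-- The colours of all translates of a finite set. -/
def profile (x a : Finset ℕ) : Bool := colour (a ∪ x)

lemma profile_injective : Function.Injective profile := by
  intro x y h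
  by_contra hne
  obtain ⟨n, -, hn⟩ := exists_colour_insert {x, y} fun a => decide (a = x)
  have hx := hn x (by simp)
  have hy := hn y (by simp)
  have hxy := congrFun h {n}
  simp only [profile, Finset.singleton_union] at hxy
  rw [hx, hy] at hxy
  simp [Ne.symm hne] at hxy

/-- The topology on finite sets generated by the colours of translates. -/
abbrev topology : TopologicalSpace (Finset ℕ) := .induced profile inferInstance

lemma exists_finset_of_isOpen {U : Set (Finset ℕ)} (hU : @IsOpen _ topology U) {x : Finset ℕ}
    (hx : x ∈ U) :
    ∃ A : Finset (Finset ℕ), ∀ y, (∀ a ∈ A, colour (a ∪ y) = colour (a ∪ x)) → y ∈ U := by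
  obtain ⟨V, hV, rfl⟩ := isOpen_induced_iff.1 hU
  obtain ⟨A, u, hu, hA⟩ := isOpen_pi_iff.1 hV _ hx
  refine ⟨A, fun y hy => hA fun a ha => ?_⟩
  have h : profile y a = profile x a := hy a ha
  rw [h]
  exact (hu a ha).2

lemma metrizableSpace : @TopologicalSpace.MetrizableSpace _ topology :=
  let _ := topology
  Topology.IsEmbedding.metrizableSpace ⟨⟨rfl⟩, profile_injective⟩

lemma continuous_union (a : Finset ℕ) : @Continuous _ _ topology topology (a ∪ ·) := by
  let _ := topology
  refine continuous_induced_rng.2 (continuous_pi fun b => ?_)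
  have h : Continuous fun x => profile x (b ∪ a) :=
    (continuous_apply (b ∪ a)).comp (continuous_induced_dom (f := profile))
  simpa only [profile, Function.comp_def, Finset.union_assoc] using h

lemma dense_order :
    @Dense _ (@instTopologicalSpaceProd _ _ topology topology)
      {p : Finset ℕ × Finset ℕ | p.1 ∪ p.2 = p.1} := by
  let _ := topology
  refine dense_iff_inter_open.2 ?_
  rintro W hW ⟨⟨x, y⟩, hxy⟩
  obtain ⟨U, V, hU, hV, hx, hy, hUV⟩ := isOpen_prod_iff.1 hW x y hxy
  obtain ⟨A, hA⟩ := exists_finset_of_isOpen hU hx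
  obtain ⟨B, hB⟩ := exists_finset_of_isOpen hV hy
  obtain ⟨n, hlt, hn⟩ := exists_colour_insert (A ∪ B) fun b => colour (b ∪ y)
  obtain ⟨m, -, hm⟩ := exists_colour_insert (A.image (insert n)) fun a => colour (a.erase n ∪ x)
  refine ⟨({m, n}, {n}), hUV ⟨hA _ fun a ha => ?_, hB _ fun b hb => ?_⟩, by simp⟩
  · have hna : n ∉ a := fun h => (hlt a (Finset.mem_union_left _ ha) n h).false
    have h := hm _ (Finset.mem_image_of_mem _ ha)
    rw [Finset.erase_insert hna] at h
    rw [← h, Finset.union_comm, Finset.insert_union, Finset.singleton_union]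
  · rw [← hn b (Finset.mem_union_right _ hb), Finset.union_comm, Finset.singleton_union]

end GenericSemilattice

/-- There exists a countable metrizable semitopological semilattice `X` whose partial order
`P = {(x, y) | x * y = x}` is dense and non-closed in `X × X`. -/
theorem stmt15 :
    ∃ (X : Type) (τ : TopologicalSpace X) (m : X → X → X),
      Countable X ∧
      @TopologicalSpace.MetrizableSpace X τ ∧
      (∀ x y z : X, m (m x y) z = m x (m y z)) ∧
      (∀ x y : X, m x y = m y x) ∧
      (∀ x : X, m x x = x) ∧
      (∀ a : X, @Continuous X X τ τ (m a)) ∧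
      @Dense (X × X) (@instTopologicalSpaceProd X X τ τ) {p : X × X | m p.1 p.2 = p.1} ∧
      ¬ @IsClosed (X × X) (@instTopologicalSpaceProd X X τ τ) {p : X × X | m p.1 p.2 = p.1} := by
  refine ⟨Finset ℕ, GenericSemilattice.topology, (· ∪ ·), inferInstance,
    GenericSemilattice.metrizableSpace, Finset.union_assoc, Finset.union_comm, Finset.union_self,
    GenericSemilattice.continuous_union, GenericSemilattice.dense_order, fun hclosed => ?_⟩
  let _ := GenericSemilattice.topology
  have huniv := hclosed.closure_eq.symm.trans GenericSemilattice.dense_order.closure_eq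
  have hmem : ((∅, {0}) : Finset ℕ × Finset ℕ) ∈ {p : Finset ℕ × Finset ℕ | p.1 ∪ p.2 = p.1} :=
    huniv ▸ Set.mem_univ _
  simp at hmem
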